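/- With notation as in the context (an algebra A over ℚ(q) with elements B, C and invertible K satisfying KB = q^{−2}BK and KC = q²CK, integers N₁, N₂ ≥ 0, and a family b(m₁,m₂) satisfying the two stated recursions and vanishing outside the box 0 ≤ m₁ ≤ N₁, 0 ≤ m₂ ≤ N₂), the following identity holds in A for every integer x with 0 ≤ x ≤ N₂ and every integer ℓ ≥ 0: b(N₁, N₂−x) · C^{(ℓ)} = Σ_{y=0}^{x} Σ_{r=0}^{N₁} (−1)^y q^{(ℓ−r)(N₂−2x+y) − ℓr − y} ⌊N₂−x+y ¦ y⌋ · C^{(ℓ−r−y)} · b(N₁−r, N₂−x+y) · K^{−r}. -/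

import Mathlib

noncomputable section

namespace DiagRk2

/-- The base field `F = ℚ(q)`. -/
abbrev F : Type := RatFunc ℚ

/-- `q^e` for `e : ℤ`. -/
def qz (e : ℤ) : F := (RatFunc.X : F) ^ e

/-- The quantum integer `[n]`. -/
def qint (n : ℤ) : F := (qz n - qz (-n)) / (qz 1 - qz (-1))

/-- The quantum factorial `[n]!`. -/
def qfact (n : ℕ) : F := ∏ i ∈ Finset.range n, qint ((i : ℤ) + 1)

/-- The balanced Gaussian binomial `⌊a ¦ k⌋ = ∏_{s=1}^{k}(q^{a−s+1}−q^{−a+s−1})/(q^s−q^{−s})`. -/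
def qbinom (a : ℤ) (k : ℕ) : F :=
  ∏ s ∈ Finset.range k,
    (qz (a - s) - qz (-(a - s))) / (qz ((s : ℤ) + 1) - qz (-((s : ℤ) + 1)))

variable {A : Type*} [Ring A] [Algebra F A]

/-- Divided power `x^{(m)} = x^m/[m]!` for `m ≥ 0`, and `0` for `m < 0`. -/
def dp (x : A) (m : ℤ) : A := if 0 ≤ m then (qfact m.toNat)⁻¹ • x ^ m.toNat else 0

end DiagRk2

open DiagRk2

namespace DiagRk2

lemma qz_add (a b : ℤ) : qz (a + b) = qz a * qz b :=
  zpow_add₀ RatFunc.X_ne_zero a b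

lemma qz_zero : qz 0 = 1 := zpow_zero _

lemma qz_sub_qz_neg_ne_zero (n : ℕ) : qz ((n : ℤ) + 1) - qz (-((n : ℤ) + 1)) ≠ 0 := by
  intro h
  have h1 : qz ((n : ℤ) + 1) * qz ((n : ℤ) + 1) = 1 := by
    calc qz ((n : ℤ) + 1) * qz ((n : ℤ) + 1)
        = qz ((n : ℤ) + 1) * qz (-((n : ℤ) + 1)) := by rw [← sub_eq_zero.mp h]
      _ = 1 := by rw [← qz_add, add_neg_cancel, qz_zero]
  have h2 : (RatFunc.X : F) ^ (2 * n + 2) = 1 := by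
    rw [← h1, ← qz_add, qz, ← zpow_natCast]
    congr 1
    push_cast
    ring
  rw [← RatFunc.algebraMap_X, ← map_pow, ← map_one (algebraMap (Polynomial ℚ) (RatFunc ℚ))] at h2
  have h3 := congrArg Polynomial.natDegree (RatFunc.algebraMap_injective ℚ h2)
  simp at h3

lemma qz_one_sub_ne_zero : qz 1 - qz (-1) ≠ 0 := by
  simpa using qz_sub_qz_neg_ne_zero 0

lemma qint_succ_ne_zero (n : ℕ) : qint ((n : ℤ) + 1) ≠ 0 :=
  div_ne_zero (qz_sub_qz_neg_ne_zero n) qz_one_sub_ne_zero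

lemma qint_zero : qint 0 = 0 := by simp [qint]

/-- `[n] = q^{y-r}[n-r-y] + q^{y-n}[y] + q^{n-r}[r]`. -/
lemma qint_eq_sum_three (n y r : ℤ) :
    qint n = qz (y - r) * qint (n - r - y) + qz (y - n) * qint y + qz (n - r) * qint r := by
  unfold qint
  rw [← mul_div_assoc, ← mul_div_assoc, ← mul_div_assoc, ← add_div, ← add_div]
  congr 1
  simp only [mul_sub, ← qz_add]
  rw [show y - r + (n - r - y) = n - 2 * r by ring,
    show y - r + -(n - r - y) = 2 * y - n by ring,
    show y - n + y = 2 * y - n by ring, show y - n + -y = -n by ring,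
    show n - r + r = n by ring, show n - r + -r = n - 2 * r by ring]
  ring

lemma qbinom_succ_mul (a : ℤ) (k : ℕ) :
    qbinom (a + 1) (k + 1) * qint ((k : ℤ) + 1) = qbinom a k * qint (a + 1) := by
  have h1 := qz_sub_qz_neg_ne_zero k
  have h2 := qz_one_sub_ne_zero
  simp only [qbinom, Finset.prod_div_distrib, qint]
  rw [Finset.prod_range_succ', Finset.prod_range_succ
    (fun s : ℕ => qz ((s : ℤ) + 1) - qz (-((s : ℤ) + 1)))]
  have h3 : ∀ s : ℕ, a + 1 - ((s + 1 : ℕ) : ℤ) = a - s := fun s => by push_cast; ring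
  simp only [h3, Nat.cast_zero, sub_zero]
  have h4 : ∏ s ∈ Finset.range k, (qz ((s : ℤ) + 1) - qz (-((s : ℤ) + 1))) ≠ 0 :=
    Finset.prod_ne_zero_iff.mpr fun s _ => qz_sub_qz_neg_ne_zero s
  field_simp

variable {A : Type*} [Ring A] [Algebra F A]

lemma dp_zero (x : A) : dp x 0 = 1 := by simp [dp, qfact]

lemma dp_of_neg (x : A) {m : ℤ} (hm : m < 0) : dp x m = 0 := if_neg (not_le.mpr hm)

lemma dp_mul_self (x : A) (m : ℤ) : dp x m * x = qint (m + 1) • dp x (m + 1) := by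
  rcases lt_or_ge m 0 with hm | hm
  · rw [dp_of_neg x hm, zero_mul]
    rcases eq_or_ne m (-1) with rfl | h
    · simp [qint_zero]
    · rw [dp_of_neg x (by omega), smul_zero]
  · lift m to ℕ using hm
    have h1 := qint_succ_ne_zero m
    rw [dp, if_pos (Int.natCast_nonneg m), dp, if_pos (by omega),
      show ((m : ℤ) + 1).toNat = m + 1 by omega, Int.toNat_natCast, smul_mul_assoc, ← pow_succ,
      smul_smul, qfact, qfact, Finset.prod_range_succ, mul_inv, mul_left_comm,
      mul_inv_cancel₀ h1, mul_one]

lemma inv_pow_mul_comm {K K' C : A} (hK : K * K' = 1) (hK' : K' * K = 1)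
    (hKC : K * C = qz 2 • (C * K)) (r : ℕ) :
    K' ^ r * C = qz (-2 * r) • (C * K' ^ r) := by
  have h1 : K' * C = qz (-2) • (C * K') := by
    have h : C * K' = qz 2 • (K' * C) := by
      calc C * K' = K' * (K * C) * K' := by rw [← mul_assoc, hK', one_mul]
        _ = qz 2 • (K' * C * (K * K')) := by
          rw [hKC, mul_smul_comm, smul_mul_assoc]; simp only [mul_assoc]
        _ = qz 2 • (K' * C) := by rw [hK, mul_one]
    rw [h, smul_smul, ← qz_add]
    simp [qz_zero]
  induction r with
  | zero => simp [qz_zero]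
  | succ r ih =>
    rw [pow_succ', mul_assoc, ih, mul_smul_comm, ← mul_assoc, h1, smul_mul_assoc, smul_smul,
      ← qz_add, mul_assoc]
    congr 2
    push_cast
    ring

/-- The coefficient of `C^{(l-r-y)} b(N₁-r, M+y) K^{-r}` in `b(N₁, M) C^{(l)}`, where
`a = N₂ - 2x` and `M = N₂ - x`. -/
def coeff (a M : ℤ) (l y r : ℕ) : F :=
  (-1 : F) ^ y * qz (((l : ℤ) - r) * (a + y) - (l : ℤ) * r - y) * qbinom (M + y) y

lemma coeff_mul_left (a M : ℤ) (l y r : ℕ) :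
    coeff a M l y r * qz (a + 2 * y - 2 * r) = coeff a M (l + 1) y r * qz ((y : ℤ) - r) := by
  have h : qz (((l : ℤ) - r) * (a + y) - (l : ℤ) * r - y) * qz (a + 2 * y - 2 * r)
      = qz ((((l + 1 : ℕ) : ℤ) - r) * (a + y) - ((l + 1 : ℕ) : ℤ) * r - y) * qz ((y : ℤ) - r) := by
    rw [← qz_add, ← qz_add]
    congr 1
    push_cast
    ring
  simp only [coeff]
  linear_combination ((-1 : F) ^ y * qbinom (M + y) y) * h

lemma coeff_raise (a M : ℤ) (l y r : ℕ) :
    -(coeff a M l y r * (qz (a + 2 * y - 2 * r) * qint (M + y + 1)))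
      = coeff a M (l + 1) (y + 1) r * (qz (((y + 1 : ℕ) : ℤ) - ((l : ℤ) + 1))
          * qint ((y + 1 : ℕ) : ℤ)) := by
  have h : qz (((l : ℤ) - r) * (a + y) - (l : ℤ) * r - y) * qz (a + 2 * y - 2 * r)
      = qz ((((l + 1 : ℕ) : ℤ) - r) * (a + (y + 1 : ℕ)) - ((l + 1 : ℕ) : ℤ) * r - (y + 1 : ℕ))
        * qz (((y + 1 : ℕ) : ℤ) - ((l : ℤ) + 1)) := by
    rw [← qz_add, ← qz_add]
    congr 1
    push_cast
    ring
  have hb := qbinom_succ_mul (M + y) y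
  simp only [coeff]
  rw [show M + ((y + 1 : ℕ) : ℤ) = M + y + 1 by push_cast; ring, pow_succ]
  rw [show qint ((y + 1 : ℕ) : ℤ) = qint ((y : ℤ) + 1) by push_cast; rfl]
  set E := qz ((((l + 1 : ℕ) : ℤ) - r) * (a + (y + 1 : ℕ)) - ((l + 1 : ℕ) : ℤ) * r - (y + 1 : ℕ))
  linear_combination (-((-1 : F) ^ y * qbinom (M + y) y * qint (M + y + 1))) * h
    + ((-1 : F) ^ y * E * qz (((y + 1 : ℕ) : ℤ) - ((l : ℤ) + 1))) * hb

lemma coeff_lower (a M : ℤ) (l y r : ℕ) :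
    coeff a M l y r * (qz (-1 - 2 * r) * qint ((r : ℤ) + 1))
      = coeff a M (l + 1) y (r + 1) * (qz ((l : ℤ) + 1 - (r + 1 : ℕ))
          * qint ((r + 1 : ℕ) : ℤ)) := by
  have h : qz (((l : ℤ) - r) * (a + y) - (l : ℤ) * r - y) * qz (-1 - 2 * r)
      = qz ((((l + 1 : ℕ) : ℤ) - (r + 1 : ℕ)) * (a + y) - ((l + 1 : ℕ) : ℤ) * (r + 1 : ℕ) - y)
        * qz ((l : ℤ) + 1 - (r + 1 : ℕ)) := by
    rw [← qz_add, ← qz_add]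
    congr 1
    push_cast
    ring
  simp only [coeff]
  rw [show qint ((r + 1 : ℕ) : ℤ) = qint ((r : ℤ) + 1) by push_cast; rfl]
  linear_combination ((-1 : F) ^ y * qbinom (M + y) y * qint ((r : ℤ) + 1)) * h

lemma sum_range_shift {G : Type*} [AddCommGroup G] (f : ℕ → G) (n : ℕ)
    (h0 : f 0 = 0) (hn : f (n + 1) = 0) :
    ∑ i ∈ Finset.range (n + 1), f (i + 1) = ∑ i ∈ Finset.range (n + 1), f i := by
  have h := Finset.sum_range_succ' f (n + 1)
  rw [Finset.sum_range_succ, h0, hn, add_zero, add_zero] at h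
  exact h.symm

lemma mul_of_recursion {K K' C : A} (hK : K * K' = 1) (hK' : K' * K = 1)
    (hKC : K * C = qz 2 • (C * K)) {N1 N2 : ℤ} {b : ℤ → ℤ → A}
    (hrecC : ∀ m1 m2 : ℤ,
      C * b m1 m2 - qz (N2 - 2 * m2) • (b m1 m2 * C)
        = qint (m2 + 1) • b m1 (m2 + 1)
          - (qz (N2 - 2 * m2 - 1) * qint (N1 - m1 + 1)) • (b (m1 - 1) m2 * K'))
    (m : ℤ) (r : ℕ) :
    b (N1 - r) m * K' ^ r * C
      = qz (2 * m - N2 - 2 * r) • (C * b (N1 - r) m * K' ^ r)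
        - (qz (2 * m - N2 - 2 * r) * qint (m + 1)) • (b (N1 - r) (m + 1) * K' ^ r)
        + (qz (-1 - 2 * r) * qint ((r : ℤ) + 1)) • (b (N1 - r - 1) m * K' ^ (r + 1)) := by
  have h1 : b (N1 - r) m * C = qz (2 * m - N2) • (C * b (N1 - r) m)
      - (qz (2 * m - N2) * qint (m + 1)) • b (N1 - r) (m + 1)
      + (qz (-1) * qint ((r : ℤ) + 1)) • (b (N1 - r - 1) m * K') := by
    have h := congrArg (fun z => qz (2 * m - N2) • z) (hrecC (N1 - r) m)
    simp only [smul_sub, smul_smul, ← mul_assoc, ← qz_add] at h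
    rw [show 2 * m - N2 + (N2 - 2 * m) = 0 by ring, qz_zero, one_smul,
      show 2 * m - N2 + (N2 - 2 * m - 1) = -1 by ring,
      show N1 - (N1 - (r : ℤ)) + 1 = r + 1 by ring] at h
    rw [sub_eq_iff_eq_add] at h
    rw [h]
    abel
  rw [mul_assoc, inv_pow_mul_comm hK hK' hKC, mul_smul_comm, ← mul_assoc, h1, add_mul, sub_mul]
  simp only [smul_mul_assoc, smul_add, smul_sub, smul_smul, ← mul_assoc, ← qz_add]
  rw [show -2 * (r : ℤ) + (2 * m - N2) = 2 * m - N2 - 2 * r by ring,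
    show -2 * (r : ℤ) + -1 = -1 - 2 * r by ring, mul_assoc (b (N1 - r - 1) m), ← pow_succ']

end DiagRk2

/-- Lemma 5.8 (`lem:qsbij`) of the paper: given `B, C` and an invertible `K` with
`KB = q^{−2}BK`, `KC = q²CK`, and a family `b(m₁,m₂)` vanishing outside
`0 ≤ m₁ ≤ N₁, 0 ≤ m₂ ≤ N₂` and satisfying the two stated recursions, for `0 ≤ x ≤ N₂` and
`ℓ ≥ 0`:
`b(N₁,N₂−x)·C^{(ℓ)} = Σ_{y=0}^{x} Σ_{r=0}^{N₁} (−1)^y q^{(ℓ−r)(N₂−2x+y)−ℓr−y}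
   ⌊N₂−x+y ¦ y⌋ · C^{(ℓ−r−y)}·b(N₁−r,N₂−x+y)·K^{−r}`. -/
theorem statement15 (A : Type*) [Ring A] [Algebra F A]
    (B C Kk Kk' : A)
    (hK : Kk * Kk' = 1) (hK' : Kk' * Kk = 1)
    (hKB : Kk * B = qz (-2) • (B * Kk))
    (hKC : Kk * C = qz 2 • (C * Kk))
    (N1 N2 : ℕ) (b : ℤ → ℤ → A)
    (hvanish : ∀ m1 m2 : ℤ,
      (m1 < 0 ∨ (N1 : ℤ) < m1 ∨ m2 < 0 ∨ (N2 : ℤ) < m2) → b m1 m2 = 0)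
    (hrecB : ∀ m1 m2 : ℤ,
      B * b m1 m2 - qz ((N1 : ℤ) - 2 * m1) • (b m1 m2 * B)
        = qint (m1 + 1) • b (m1 + 1) m2
          - (qz ((N1 : ℤ) - 2 * m1 - 1) * qint ((N2 : ℤ) - m2 + 1)) • (b m1 (m2 - 1) * Kk))
    (hrecC : ∀ m1 m2 : ℤ,
      C * b m1 m2 - qz ((N2 : ℤ) - 2 * m2) • (b m1 m2 * C)
        = qint (m2 + 1) • b m1 (m2 + 1)
          - (qz ((N2 : ℤ) - 2 * m2 - 1) * qint ((N1 : ℤ) - m1 + 1)) • (b (m1 - 1) m2 * Kk'))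
    (x : ℕ) (hx : x ≤ N2) (l : ℕ) :
    b (N1 : ℤ) ((N2 : ℤ) - x) * dp C (l : ℤ)
      = ∑ y ∈ Finset.range (x + 1), ∑ r ∈ Finset.range (N1 + 1),
          (((-1 : F) ^ y *
              qz (((l : ℤ) - r) * ((N2 : ℤ) - 2 * x + y) - (l : ℤ) * r - y)) *
              qbinom ((N2 : ℤ) - x + y) y) •
            (dp C ((l : ℤ) - r - y) * b ((N1 : ℤ) - r) ((N2 : ℤ) - x + y) * Kk' ^ r) := by
  set a : ℤ := (N2 : ℤ) - 2 * x with ha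
  set M : ℤ := (N2 : ℤ) - x with hM
  change _ = ∑ y ∈ Finset.range (x + 1), ∑ r ∈ Finset.range (N1 + 1),
    coeff a M l y r • (dp C ((l : ℤ) - r - y) * b ((N1 : ℤ) - r) (M + y) * Kk' ^ r)
  induction l with
  | zero =>
    rw [Finset.sum_eq_single 0, Finset.sum_eq_single 0]
    · simp [coeff, qbinom, dp_zero, qz_zero]
    · intro r _ hr
      rw [dp_of_neg C (by push_cast; omega), zero_mul, zero_mul, smul_zero]
    · simp
    · intro y _ hy
      refine Finset.sum_eq_zero fun r _ => ?_
      rw [dp_of_neg C (by push_cast; omega), zero_mul, zero_mul, smul_zero]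
    · simp
  | succ l ih =>
    have hl := qint_succ_ne_zero l
    let X : ℕ → ℕ → A := fun y r =>
      dp C (((l + 1 : ℕ) : ℤ) - r - y) * b ((N1 : ℤ) - r) (M + y) * Kk' ^ r
    have hX1 : ∀ r, X (x + 1) r = 0 := fun r => by
      simp only [X]
      rw [hvanish _ (M + (x + 1 : ℕ)) (by omega), mul_zero, zero_mul]
    have hX2 : ∀ y, X y (N1 + 1) = 0 := fun y => by
      simp only [X]
      rw [hvanish ((N1 : ℤ) - (N1 + 1 : ℕ)) _ (by omega), mul_zero, zero_mul]
    let α : ℕ → ℕ → A := fun y r => (coeff a M (l + 1) y r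
      * (qz ((y : ℤ) - r) * qint ((l : ℤ) + 1 - r - y))) • X y r
    let β : ℕ → ℕ → A := fun y r => (coeff a M (l + 1) y r
      * (qz ((y : ℤ) - ((l : ℤ) + 1)) * qint y)) • X y r
    let γ : ℕ → ℕ → A := fun y r => (coeff a M (l + 1) y r
      * (qz ((l : ℤ) + 1 - r) * qint r)) • X y r
    have hterm : ∀ y r : ℕ,
        coeff a M l y r • (dp C ((l : ℤ) - r - y) * b ((N1 : ℤ) - r) (M + y) * Kk' ^ r) * C
          = α y r + β (y + 1) r + γ y (r + 1) := fun y r => by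
      simp only [α, β, γ, X]
      rw [← coeff_raise, ← coeff_lower, ← mul_assoc (coeff a M (l + 1) y r), ← coeff_mul_left,
        smul_mul_assoc, mul_assoc (dp C _), mul_assoc (dp C _),
        mul_of_recursion hK hK' hKC hrecC (M + y) r,
        show 2 * (M + y) - (N2 : ℤ) - 2 * r = a + 2 * y - 2 * r by rw [ha, hM]; ring,
        mul_add, mul_sub, mul_smul_comm, mul_smul_comm, mul_smul_comm,
        mul_assoc C, ← mul_assoc _ C, dp_mul_self]
      rw [show (l : ℤ) - r - y + 1 = (l : ℤ) + 1 - r - y by ring,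
        show ((l + 1 : ℕ) : ℤ) - r - y = (l : ℤ) + 1 - r - y by push_cast; ring,
        show ((l + 1 : ℕ) : ℤ) - r - (y + 1 : ℕ) = (l : ℤ) - r - y by push_cast; ring,
        show ((l + 1 : ℕ) : ℤ) - (r + 1 : ℕ) - y = (l : ℤ) - r - y by push_cast; ring,
        show M + ((y + 1 : ℕ) : ℤ) = M + y + 1 by push_cast; ring,
        show (N1 : ℤ) - ((r + 1 : ℕ) : ℤ) = N1 - r - 1 by push_cast; ring]
      simp only [smul_add, smul_sub, smul_smul, smul_mul_assoc, neg_smul, mul_assoc]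
      abel
    have hβ : ∀ r, ∑ y ∈ Finset.range (x + 1), β (y + 1) r
        = ∑ y ∈ Finset.range (x + 1), β y r := fun r =>
      sum_range_shift (fun y => β y r) x (by simp [β, qint_zero]) (by simp only [β, hX1, smul_zero])
    have hγ : ∀ y, ∑ r ∈ Finset.range (N1 + 1), γ y (r + 1)
        = ∑ r ∈ Finset.range (N1 + 1), γ y r := fun y =>
      sum_range_shift (fun r => γ y r) N1 (by simp [γ, qint_zero])
        (by simp only [γ, hX2, smul_zero])
    have hcomb : ∀ y r : ℕ, α y r + β y r + γ y r
        = qint ((l : ℤ) + 1) • (coeff a M (l + 1) y r • X y r) := fun y r => by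
      simp only [α, β, γ]
      rw [← add_smul, ← add_smul, smul_smul, qint_eq_sum_three ((l : ℤ) + 1) y r]
      congr 1
      ring
    have hsum : qint ((l : ℤ) + 1) • (b N1 M * dp C ((l + 1 : ℕ) : ℤ))
        = qint ((l : ℤ) + 1) • ∑ y ∈ Finset.range (x + 1), ∑ r ∈ Finset.range (N1 + 1),
            coeff a M (l + 1) y r • X y r := by
      rw [← mul_smul_comm, Nat.cast_succ, ← dp_mul_self, ← mul_assoc, ih]
      simp only [Finset.sum_mul, hterm, Finset.smul_sum, ← hcomb, Finset.sum_add_distrib, hγ]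
      rw [Finset.sum_comm (f := fun y r => β (y + 1) r), Finset.sum_comm (f := fun y r => β y r)]
      simp only [hβ]
    exact smul_right_injective A hl hsum
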